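/- arXiv:1501.02708 — 3 statements merged into one kernel-verified Lean document; each statement's English description precedes it below -/
import Mathlib

section
/- Every unitary on the 2 × d_B system (d_B ≥ 1) has a 3-A form: it is the product of three controlled unitaries, each of which is a controlled unitary from the A side. -/
open Matrix Kronecker BigOperators

/-- `U` is controlled from the A side in the computational basis. -/
def CtrlAcb {dA dB : ℕ} (U : Matrix (Fin dA × Fin dB) (Fin dA × Fin dB) ℂ) : Prop :=
  ∀ p q : Fin dA × Fin dB, p.1 ≠ q.1 → U p q = 0

/-- `U` is controlled from the B side in the computational basis. -/
def CtrlBcb {dA dB : ℕ} (U : Matrix (Fin dA × Fin dB) (Fin dA × Fin dB) ℂ) : Prop :=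
  ∀ p q : Fin dA × Fin dB, p.2 ≠ q.2 → U p q = 0

/-- `U` is a controlled unitary from the A side (up to local unitaries on the A factor). -/
def IsCtrlA {dA dB : ℕ} (U : Matrix (Fin dA × Fin dB) (Fin dA × Fin dB) ℂ) : Prop :=
  ∃ X Y : Matrix (Fin dA) (Fin dA) ℂ,
    X ∈ Matrix.unitaryGroup (Fin dA) ℂ ∧ Y ∈ Matrix.unitaryGroup (Fin dA) ℂ ∧
    CtrlAcb ((X ⊗ₖ (1 : Matrix (Fin dB) (Fin dB) ℂ)) * U * (Y ⊗ₖ (1 : Matrix (Fin dB) (Fin dB) ℂ)))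

/-- `U` is a controlled unitary from the B side (up to local unitaries on the B factor). -/
def IsCtrlB {dA dB : ℕ} (U : Matrix (Fin dA × Fin dB) (Fin dA × Fin dB) ℂ) : Prop :=
  ∃ X Y : Matrix (Fin dB) (Fin dB) ℂ,
    X ∈ Matrix.unitaryGroup (Fin dB) ℂ ∧ Y ∈ Matrix.unitaryGroup (Fin dB) ℂ ∧
    CtrlBcb (((1 : Matrix (Fin dA) (Fin dA) ℂ) ⊗ₖ X) * U * ((1 : Matrix (Fin dA) (Fin dA) ℂ) ⊗ₖ Y))

/-- `U` is a controlled unitary: a unitary controlled from the A side or from the B side. -/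
def IsCtrlUnitary {dA dB : ℕ} (U : Matrix (Fin dA × Fin dB) (Fin dA × Fin dB) ℂ) : Prop :=
  U ∈ Matrix.unitaryGroup (Fin dA × Fin dB) ℂ ∧ (IsCtrlA U ∨ IsCtrlB U)

/-- The SWAP gate on the `d × d` system. -/
def Swap (d : ℕ) : Matrix (Fin d × Fin d) (Fin d × Fin d) ℂ :=
  fun p q => if p.1 = q.2 ∧ p.2 = q.1 then 1 else 0

/-- The operator on the `2 × d` system with the given `d × d` blocks. -/
def qubitBlocks {d : ℕ} (A B C D : Matrix (Fin d) (Fin d) ℂ) :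
    Matrix (Fin 2 × Fin d) (Fin 2 × Fin d) ℂ :=
  fun p q => (!![A, B; C, D] : Matrix (Fin 2) (Fin 2) (Matrix (Fin d) (Fin d) ℂ)) p.1 q.1 p.2 q.2

section qubitBlocks

variable {d : ℕ}

theorem exists_eq_qubitBlocks (U : Matrix (Fin 2 × Fin d) (Fin 2 × Fin d) ℂ) :
    ∃ A B C D, U = qubitBlocks A B C D := by
  refine ⟨fun i j => U (0, i) (0, j), fun i j => U (0, i) (1, j),
    fun i j => U (1, i) (0, j), fun i j => U (1, i) (1, j), ?_⟩
  ext ⟨a, i⟩ ⟨b, j⟩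
  fin_cases a <;> fin_cases b <;> rfl

theorem qubitBlocks_mul (A B C D A' B' C' D' : Matrix (Fin d) (Fin d) ℂ) :
    qubitBlocks A B C D * qubitBlocks A' B' C' D' =
      qubitBlocks (A * A' + B * C') (A * B' + B * D') (C * A' + D * C') (C * B' + D * D') := by
  ext ⟨a, i⟩ ⟨b, j⟩
  fin_cases a <;> fin_cases b <;>
    simp [qubitBlocks, Matrix.mul_apply, Fintype.sum_prod_type]

theorem star_qubitBlocks (A B C D : Matrix (Fin d) (Fin d) ℂ) :
    star (qubitBlocks A B C D) = qubitBlocks (star A) (star C) (star B) (star D) := by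
  ext ⟨a, i⟩ ⟨b, j⟩
  fin_cases a <;> fin_cases b <;> simp [qubitBlocks, Matrix.star_apply]

theorem qubitBlocks_one :
    qubitBlocks 1 0 0 1 = (1 : Matrix (Fin 2 × Fin d) (Fin 2 × Fin d) ℂ) := by
  ext ⟨a, i⟩ ⟨b, j⟩
  fin_cases a <;> fin_cases b <;> simp [qubitBlocks, Matrix.one_apply]

theorem kronecker_one_eq_qubitBlocks (a b c e : ℂ) :
    !![a, b; c, e] ⊗ₖ (1 : Matrix (Fin d) (Fin d) ℂ) =
      qubitBlocks (a • 1) (b • 1) (c • 1) (e • 1) := by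
  ext ⟨i, k⟩ ⟨j, l⟩
  fin_cases i <;> fin_cases j <;> simp [qubitBlocks]

theorem qubitBlocks_inj {A B C D A' B' C' D' : Matrix (Fin d) (Fin d) ℂ} :
    qubitBlocks A B C D = qubitBlocks A' B' C' D' ↔ A = A' ∧ B = B' ∧ C = C' ∧ D = D' := by
  refine ⟨fun h => ⟨?_, ?_, ?_, ?_⟩, by rintro ⟨rfl, rfl, rfl, rfl⟩; rfl⟩ <;> ext i j
  · simpa [qubitBlocks] using congr_fun₂ h (0, i) (0, j)
  · simpa [qubitBlocks] using congr_fun₂ h (0, i) (1, j)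
  · simpa [qubitBlocks] using congr_fun₂ h (1, i) (0, j)
  · simpa [qubitBlocks] using congr_fun₂ h (1, i) (1, j)

theorem ctrlAcb_qubitBlocks (A D : Matrix (Fin d) (Fin d) ℂ) :
    CtrlAcb (qubitBlocks A 0 0 D) := by
  rintro ⟨a, i⟩ ⟨b, j⟩ h
  fin_cases a <;> fin_cases b <;> simp_all [qubitBlocks]

theorem isCtrlA_qubitBlocks_diag (A D : Matrix (Fin d) (Fin d) ℂ) :
    IsCtrlA (qubitBlocks A 0 0 D) :=
  ⟨1, 1, one_mem _, one_mem _, by simpa using ctrlAcb_qubitBlocks A D⟩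

theorem qubitBlocks_diag_mem_unitaryGroup {A D : Matrix (Fin d) (Fin d) ℂ}
    (hA : A ∈ unitaryGroup (Fin d) ℂ) (hD : D ∈ unitaryGroup (Fin d) ℂ) :
    qubitBlocks A 0 0 D ∈ unitaryGroup (Fin 2 × Fin d) ℂ := by
  rw [mem_unitaryGroup_iff'] at *
  simp [star_qubitBlocks, qubitBlocks_mul, hA, hD, qubitBlocks_one]

/-- A block rotation is diagonalised by the eigenbasis of the Pauli matrix `Y` on the qubit. -/
theorem isCtrlA_qubitBlocks_rotation (C S : Matrix (Fin d) (Fin d) ℂ) :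
    IsCtrlA (qubitBlocks C (-S) S C) := by
  obtain ⟨r, hr, hrs⟩ : ∃ r : ℂ, r * r = 2⁻¹ ∧ starRingEnd ℂ r = r := by
    refine ⟨((√2 : ℝ) : ℂ)⁻¹, ?_, by simp⟩
    rw [← mul_inv, ← Complex.ofReal_mul, Real.mul_self_sqrt (by norm_num)]
    norm_num
  let X : Matrix (Fin 2) (Fin 2) ℂ := !![r, -(r * Complex.I); r, r * Complex.I]
  have hXs : star X = !![r, r; r * Complex.I, -(r * Complex.I)] := by
    ext i j
    fin_cases i <;> fin_cases j <;> simp [X, Matrix.star_apply, hrs]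
  have hX : X ∈ unitaryGroup (Fin 2) ℂ := by
    rw [mem_unitaryGroup_iff, hXs]
    ext i j
    fin_cases i <;> fin_cases j <;> simp [X, Matrix.mul_apply]
    · linear_combination 2 * hr - r * r * Complex.I_mul_I
    · linear_combination r * r * Complex.I_mul_I
    · linear_combination r * r * Complex.I_mul_I
    · linear_combination 2 * hr - r * r * Complex.I_mul_I
  refine ⟨X, star X, hX, Unitary.star_mem hX, ?_⟩
  rw [hXs]
  simp only [X, kronecker_one_eq_qubitBlocks, qubitBlocks_mul]
  convert ctrlAcb_qubitBlocks _ _ using 2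
  · ext i j
    simp
    linear_combination r * r * C i j * Complex.I_mul_I
  · ext i j
    simp
    linear_combination r * r * C i j * Complex.I_mul_I

theorem qubitBlocks_rotation_mem_unitaryGroup {C S : Matrix (Fin d) (Fin d) ℂ}
    (hC : star C = C) (hS : star S = S) (hCS : C * S = S * C) (h : C * C + S * S = 1) :
    qubitBlocks C (-S) S C ∈ unitaryGroup (Fin 2 × Fin d) ℂ := by
  rw [mem_unitaryGroup_iff', star_qubitBlocks, qubitBlocks_mul, ← qubitBlocks_one,
    qubitBlocks_inj]
  simp [hC, hS, hCS, h, add_comm (S * S)]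

/-- A unitary whose first block column is `(1, 0)` is block diagonal. -/
theorem eq_zero_of_qubitBlocks_mem_unitaryGroup {B D : Matrix (Fin d) (Fin d) ℂ}
    (h : qubitBlocks 1 B 0 D ∈ unitaryGroup (Fin 2 × Fin d) ℂ) : B = 0 := by
  rw [mem_unitaryGroup_iff', star_qubitBlocks, qubitBlocks_mul, ← qubitBlocks_one,
    qubitBlocks_inj] at h
  simpa using h.2.1

end qubitBlocks

/-- A square matrix with orthogonal columns is a unitary times the diagonal matrix of the norms of
its columns. -/
theorem exists_unitary_mul_diagonal_sqrt {n : Type*} [Fintype n] [DecidableEq n]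
    (A : Matrix n n ℂ) (l : n → ℝ) (hA : star A * A = diagonal fun i => (l i : ℂ)) :
    ∃ P ∈ unitaryGroup n ℂ, A = P * diagonal fun i => ((√(l i) : ℝ) : ℂ) := by
  let c : n → EuclideanSpace ℂ n := fun i => WithLp.toLp 2 (A.col i)
  have hc : ∀ i j, inner ℂ (c i) (c j) = if i = j then (l i : ℂ) else 0 := by
    intro i j
    have := congr_fun₂ hA i j
    rw [diagonal_apply] at this
    rw [← this]
    simp [c, Matrix.mul_apply, PiLp.inner_apply, Matrix.star_apply, mul_comm]
  have hn : ∀ i, ‖c i‖ = √(l i) := by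
    intro i
    rw [@norm_eq_sqrt_re_inner ℂ, hc]
    simp
  let v : n → EuclideanSpace ℂ n := fun i => ((√(l i) : ℝ) : ℂ)⁻¹ • c i
  let s : Set n := {i | √(l i) ≠ 0}
  have hv : Orthonormal ℂ (s.domRestrict v) := by
    refine ⟨fun i => ?_, fun i j hij => ?_⟩
    · have hi : √(l i) ≠ 0 := i.2
      simp [v, Set.domRestrict, norm_smul, hn, abs_of_nonneg (Real.sqrt_nonneg _), hi]
    · have : (i : n) ≠ j := fun h => hij (Subtype.ext h)
      simp [v, Set.domRestrict, inner_smul_left, inner_smul_right, hc, this]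
  obtain ⟨b, hb⟩ := hv.exists_orthonormalBasis_extension_of_card_eq (by simp)
  refine ⟨of fun i j => b j i, ?_, ?_⟩
  · rw [mem_unitaryGroup_iff']
    ext i j
    have := orthonormal_iff_ite.1 b.orthonormal i j
    simpa [Matrix.mul_apply, PiLp.inner_apply, Matrix.star_apply, mul_comm, one_apply] using this
  · ext i j
    rw [mul_diagonal]
    by_cases hj : √(l j) = 0
    · have : c j = 0 := by rw [← norm_eq_zero, hn, hj]
      simpa [hj, c] using congr_arg (fun x : EuclideanSpace ℂ n => x i) this
    · have hj' : ((√(l j) : ℝ) : ℂ) ≠ 0 := by exact_mod_cast hj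
      simp [hb j hj, v, c]
      field_simp

open scoped ComplexOrder in
/-- The entries of a real diagonal Gram matrix are nonnegative. -/
theorem nonneg_of_star_mul_self_eq_diagonal {n : Type*} [Fintype n] [DecidableEq n]
    {A : Matrix n n ℂ} {l : n → ℝ} (hA : star A * A = diagonal fun i => (l i : ℂ)) (i : n) :
    0 ≤ l i := by
  have h := (posSemidef_conjTranspose_mul_self A).diag_nonneg (i := i)
  rw [← star_eq_conjTranspose, hA, diagonal_apply_eq] at h
  exact_mod_cast h

/-- Every unitary on the `2 × d_B` system is the product of three controlled unitaries
from the A side (a 3-A form). -/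
theorem two_by_d_threeA (dB : ℕ) (hdB : 1 ≤ dB)
    (U : Matrix (Fin 2 × Fin dB) (Fin 2 × Fin dB) ℂ)
    (hU : U ∈ Matrix.unitaryGroup (Fin 2 × Fin dB) ℂ) :
    ∃ U₁ U₂ U₃ : Matrix (Fin 2 × Fin dB) (Fin 2 × Fin dB) ℂ,
      U₁ ∈ Matrix.unitaryGroup (Fin 2 × Fin dB) ℂ ∧
      U₂ ∈ Matrix.unitaryGroup (Fin 2 × Fin dB) ℂ ∧
      U₃ ∈ Matrix.unitaryGroup (Fin 2 × Fin dB) ℂ ∧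
      IsCtrlA U₁ ∧ IsCtrlA U₂ ∧ IsCtrlA U₃ ∧ U = U₁ * U₂ * U₃ := by
  obtain ⟨A, B, C, D, rfl⟩ := exists_eq_qubitBlocks U
  have hAC : star A * A + star C * C = 1 := by
    have h := mem_unitaryGroup_iff'.1 hU
    rw [star_qubitBlocks, qubitBlocks_mul, ← qubitBlocks_one, qubitBlocks_inj] at h
    exact h.1
  have hH : (star A * A).IsHermitian := isHermitian_conjTranspose_mul_self A
  let E : Matrix (Fin dB) (Fin dB) ℂ := hH.eigenvectorUnitary
  have hE : E ∈ unitaryGroup (Fin dB) ℂ := hH.eigenvectorUnitary.2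
  have hEE : star E * E = 1 := mem_unitaryGroup_iff'.1 hE
  let l := hH.eigenvalues
  have hA : star (A * E) * (A * E) = diagonal fun i => (l i : ℂ) := by
    have h := hH.conjStarAlgAut_star_eigenvectorUnitary
    rw [Unitary.conjStarAlgAut_star_apply] at h
    rw [star_mul]
    simp only [mul_assoc] at h ⊢
    exact h
  have hC : star (C * E) * (C * E) = diagonal fun i => ((1 - l i : ℝ) : ℂ) := by
    have h : star (C * E) * (C * E) = star E * E - star (A * E) * (A * E) := by
      have hCC : star C * C = 1 - star A * A := eq_sub_of_add_eq' hAC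
      calc star (C * E) * (C * E) = star E * (star C * C) * E := by
            simp only [star_mul, mul_assoc]
        _ = _ := by
            rw [hCC]
            simp only [star_mul, mul_assoc, mul_sub, sub_mul, one_mul]
    rw [h, hEE, hA, ← diagonal_one, diagonal_sub]
    simp
  obtain ⟨P₀, hP₀, hAP⟩ := exists_unitary_mul_diagonal_sqrt _ _ hA
  obtain ⟨P₁, hP₁, hCP⟩ := exists_unitary_mul_diagonal_sqrt _ _ hC
  have hl₀ := nonneg_of_star_mul_self_eq_diagonal hA
  have hl₁ := nonneg_of_star_mul_self_eq_diagonal hC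
  set c : Matrix (Fin dB) (Fin dB) ℂ := diagonal fun i => ((√(l i) : ℝ) : ℂ) with hc
  set s : Matrix (Fin dB) (Fin dB) ℂ := diagonal fun i => ((√(1 - l i) : ℝ) : ℂ) with hs
  have hcs : c * s = s * c := by simp [hc, hs, mul_comm]
  have hcc : c * c + s * s = 1 := by
    simp only [hc, hs, diagonal_mul_diagonal, diagonal_add, ← Complex.ofReal_mul,
      Real.mul_self_sqrt (hl₀ _), Real.mul_self_sqrt (hl₁ _)]
    simp
  have hc' : star c = c := by
    simp [hc, star_eq_conjTranspose, diagonal_conjTranspose, Pi.star_def]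
  have hs' : star s = s := by
    simp [hs, star_eq_conjTranspose, diagonal_conjTranspose, Pi.star_def]
  have hN := qubitBlocks_rotation_mem_unitaryGroup hc' hs' hcs hcc
  have hP := qubitBlocks_diag_mem_unitaryGroup hP₀ hP₁
  have hV := qubitBlocks_diag_mem_unitaryGroup hE (one_mem (unitaryGroup (Fin dB) ℂ))
  have hQ := mul_mem (mul_mem (Unitary.star_mem hN) (Unitary.star_mem hP)) (mul_mem hU hV)
  obtain ⟨Q, hQeq⟩ : ∃ Q, star (qubitBlocks c (-s) s c) * star (qubitBlocks P₀ 0 0 P₁) *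
      (qubitBlocks A B C D * qubitBlocks E 0 0 1) = qubitBlocks 1 0 0 Q := by
    have hPA : star P₀ * (A * E) = c := by
      rw [hAP, ← mul_assoc, mem_unitaryGroup_iff'.1 hP₀, one_mul]
    have hPC : star P₁ * (C * E) = s := by
      rw [hCP, ← mul_assoc, mem_unitaryGroup_iff'.1 hP₁, one_mul]
    simp only [star_qubitBlocks, qubitBlocks_mul, star_zero, star_neg, mul_zero, add_zero,
      zero_add, mul_one, hc', hs', mul_assoc, hPA, hPC, hcc, neg_mul, hcs, neg_add_cancel] at hQ ⊢
    rw [eq_zero_of_qubitBlocks_mem_unitaryGroup hQ]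
    exact ⟨_, rfl⟩
  rw [hQeq] at hQ
  refine ⟨_, _, _, hP, hN, mul_mem hQ (Unitary.star_mem hV), isCtrlA_qubitBlocks_diag _ _,
    isCtrlA_qubitBlocks_rotation _ _, ?_, ?_⟩
  · simp only [star_qubitBlocks, qubitBlocks_mul, star_zero, mul_zero, zero_mul, add_zero, zero_add]
    exact isCtrlA_qubitBlocks_diag _ _
  · rw [← hQeq]
    simp only [mul_assoc]
    rw [mem_unitaryGroup_iff.1 hV, mul_one, ← mul_assoc (qubitBlocks c (-s) s c),
      mem_unitaryGroup_iff.1 hN, one_mul, ← mul_assoc, mem_unitaryGroup_iff.1 hP, one_mul]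
end

section
/- There exists a unitary on the 2 × 2 system that cannot be written as the product of two controlled unitaries. -/
open Matrix Kronecker BigOperators

lemma CtrlAcb.mul_apply {dA dB : ℕ} {D : Matrix (Fin dA × Fin dB) (Fin dA × Fin dB) ℂ}
    (hD : CtrlAcb D) (M : Matrix (Fin dA × Fin dB) (Fin dA × Fin dB) ℂ)
    (i : Fin dA) (k : Fin dB) (q : Fin dA × Fin dB) :
    (D * M) (i, k) q = ∑ b, D (i, k) (i, b) * M (i, b) q := by
  rw [Matrix.mul_apply, Fintype.sum_prod_type, Finset.sum_eq_single i]
  · intro a _ ha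
    exact Finset.sum_eq_zero fun b _ => by rw [hD (i, k) (a, b) ha.symm, zero_mul]
  · simp

lemma CtrlAcb.apply_mul {dA dB : ℕ} {D : Matrix (Fin dA × Fin dB) (Fin dA × Fin dB) ℂ}
    (hD : CtrlAcb D) (M : Matrix (Fin dA × Fin dB) (Fin dA × Fin dB) ℂ)
    (j : Fin dA) (l : Fin dB) (p : Fin dA × Fin dB) :
    (M * D) p (j, l) = ∑ b, M p (j, b) * D (j, b) (j, l) := by
  rw [Matrix.mul_apply, Fintype.sum_prod_type, Finset.sum_eq_single j]
  · intro a _ ha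
    exact Finset.sum_eq_zero fun b _ => by rw [hD (a, b) (j, l) ha, mul_zero]
  · simp

lemma CtrlBcb.apply_mul {dA dB : ℕ} {D : Matrix (Fin dA × Fin dB) (Fin dA × Fin dB) ℂ}
    (hD : CtrlBcb D) (M : Matrix (Fin dA × Fin dB) (Fin dA × Fin dB) ℂ)
    (j : Fin dA) (l : Fin dB) (p : Fin dA × Fin dB) :
    (M * D) p (j, l) = ∑ c, M p (c, l) * D (c, l) (j, l) := by
  rw [Matrix.mul_apply, Fintype.sum_prod_type_right, Finset.sum_eq_single l]
  · intro a _ ha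
    exact Finset.sum_eq_zero fun b _ => by rw [hD (b, a) (j, l) ha, mul_zero]
  · simp

/-- The diagonal blocks of a block diagonal unitary are invertible. -/
lemma CtrlAcb.det_block_ne_zero {dA dB : ℕ} {D : Matrix (Fin dA × Fin dB) (Fin dA × Fin dB) ℂ}
    (hD : CtrlAcb D) (hU : D ∈ Matrix.unitaryGroup (Fin dA × Fin dB) ℂ) (i : Fin dA) :
    (D.submatrix (Prod.mk i) (Prod.mk i)).det ≠ 0 := by
  have h : D.submatrix (Prod.mk i) (Prod.mk i) * (star D).submatrix (Prod.mk i) (Prod.mk i)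
      = 1 := by
    ext k l
    have := hD.mul_apply (star D) i k (i, l)
    rw [Matrix.mem_unitaryGroup_iff.mp hU] at this
    simpa [Matrix.mul_apply, Matrix.one_apply] using this.symm
  exact Matrix.det_ne_zero_of_right_inverse h

lemma exists_apply_ne_zero_of_mem_unitaryGroup {K : Matrix (Fin 2) (Fin 2) ℂ}
    (hK : K ∈ Matrix.unitaryGroup (Fin 2) ℂ) : ∃ i j, K i j ≠ 0 := by
  by_contra! h
  have h0 : K = 0 := by ext i j; exact h i j
  have := Matrix.mem_unitaryGroup_iff.mp hK
  simp [h0] at this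

lemma kronecker_one_mul_swap_mul_kronecker_one_apply {d : ℕ} (X Y : Matrix (Fin d) (Fin d) ℂ)
    (i k j l : Fin d) :
    ((X ⊗ₖ (1 : Matrix (Fin d) (Fin d) ℂ)) * Swap d * (Y ⊗ₖ (1 : Matrix (Fin d) (Fin d) ℂ)))
      (i, k) (j, l) = X i l * Y k j := by
  simp [Matrix.mul_apply, Fintype.sum_prod_type, Swap, Matrix.one_apply, ite_and]

lemma kronecker_one_mul_swap_mul_one_kronecker_apply {d : ℕ} (X Y : Matrix (Fin d) (Fin d) ℂ)
    (i k j l : Fin d) :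
    ((X ⊗ₖ (1 : Matrix (Fin d) (Fin d) ℂ)) * Swap d * ((1 : Matrix (Fin d) (Fin d) ℂ) ⊗ₖ Y))
      (i, k) (j, l) = if k = j then (X * Y) i l else 0 := by
  simp [Matrix.mul_apply, Fintype.sum_prod_type, Swap, Matrix.one_apply, ite_and]

lemma kronecker_one_mem_unitaryGroup {dA dB : ℕ} {X : Matrix (Fin dA) (Fin dA) ℂ}
    (hX : X ∈ Matrix.unitaryGroup (Fin dA) ℂ) :
    X ⊗ₖ (1 : Matrix (Fin dB) (Fin dB) ℂ) ∈ Matrix.unitaryGroup (Fin dA × Fin dB) ℂ :=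
  Matrix.kronecker_mem_unitary hX (one_mem _)

lemma swap_ne_mul_of_isCtrlA_of_isCtrlA {U V : Matrix (Fin 2 × Fin 2) (Fin 2 × Fin 2) ℂ}
    (hU : U ∈ Matrix.unitaryGroup (Fin 2 × Fin 2) ℂ)
    (hV : V ∈ Matrix.unitaryGroup (Fin 2 × Fin 2) ℂ)
    (hUA : IsCtrlA U) (hVA : IsCtrlA V) : Swap 2 ≠ U * V := by
  intro hS
  obtain ⟨X, Y, hX, hY, hD⟩ := hUA
  obtain ⟨Z, W, hZ, hW, hE⟩ := hVA
  have hDU := mul_mem (mul_mem (kronecker_one_mem_unitaryGroup (dB := 2) hX) hU)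
    (kronecker_one_mem_unitaryGroup hY)
  have hEU := mul_mem (mul_mem (kronecker_one_mem_unitaryGroup (dB := 2) hZ) hV)
    (kronecker_one_mem_unitaryGroup hW)
  have hK : star Y * star Z ∈ Matrix.unitaryGroup (Fin 2) ℂ :=
    mul_mem (Unitary.star_mem hY) (Unitary.star_mem hZ)
  have hmid : (Y ⊗ₖ (1 : Matrix (Fin 2) (Fin 2) ℂ)) *
      ((star Y * star Z) ⊗ₖ (1 : Matrix (Fin 2) (Fin 2) ℂ)) *
      (Z ⊗ₖ (1 : Matrix (Fin 2) (Fin 2) ℂ)) = 1 := by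
    rw [← Matrix.mul_kronecker_mul, ← Matrix.mul_kronecker_mul, ← mul_assoc Y,
      Matrix.mem_unitaryGroup_iff.mp hY, one_mul, Matrix.mem_unitaryGroup_iff'.mp hZ]
    simp
  set D := (X ⊗ₖ (1 : Matrix (Fin 2) (Fin 2) ℂ)) * U * (Y ⊗ₖ (1 : Matrix (Fin 2) (Fin 2) ℂ))
    with hDdef
  set E := (Z ⊗ₖ (1 : Matrix (Fin 2) (Fin 2) ℂ)) * V * (W ⊗ₖ (1 : Matrix (Fin 2) (Fin 2) ℂ))
    with hEdef
  set K := star Y * star Z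
  have key : D * (K ⊗ₖ (1 : Matrix (Fin 2) (Fin 2) ℂ)) * E =
      (X ⊗ₖ (1 : Matrix (Fin 2) (Fin 2) ℂ)) * Swap 2 *
        (W ⊗ₖ (1 : Matrix (Fin 2) (Fin 2) ℂ)) := by
    calc _ = (X ⊗ₖ (1 : Matrix (Fin 2) (Fin 2) ℂ)) * U *
          ((Y ⊗ₖ (1 : Matrix (Fin 2) (Fin 2) ℂ)) * (K ⊗ₖ (1 : Matrix (Fin 2) (Fin 2) ℂ)) *
          (Z ⊗ₖ (1 : Matrix (Fin 2) (Fin 2) ℂ))) * V *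
          (W ⊗ₖ (1 : Matrix (Fin 2) (Fin 2) ℂ)) := by
          simp only [hDdef, hEdef, mul_assoc]
      _ = _ := by rw [hmid, hS]; simp only [mul_assoc, one_mul]
  obtain ⟨i, j, hij⟩ := exists_apply_ne_zero_of_mem_unitaryGroup hK
  have hblock : K i j • (D.submatrix (Prod.mk i) (Prod.mk i) *
      E.submatrix (Prod.mk j) (Prod.mk j)) = Matrix.of fun k l => X i l * W k j := by
    ext k l
    have := congrFun (congrFun key (i, k)) (j, l)
    rw [kronecker_one_mul_swap_mul_kronecker_one_apply, hE.apply_mul] at this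
    simp only [hD.mul_apply, Matrix.kroneckerMap_apply] at this
    simp only [Matrix.of_apply, ← this, Matrix.smul_apply, Matrix.mul_apply,
      Fin.sum_univ_two, Matrix.submatrix_apply, smul_eq_mul]
    simp
    ring
  have hdet := congrArg Matrix.det hblock
  rw [Matrix.det_smul, Matrix.det_mul, Matrix.det_fin_two (Matrix.of _)] at hdet
  refine mul_ne_zero (pow_ne_zero _ hij)
    (mul_ne_zero (hD.det_block_ne_zero hDU i) (hE.det_block_ne_zero hEU j)) (hdet.trans ?_)
  simp only [Matrix.of_apply]
  ring

lemma swap_ne_mul_of_isCtrlA_of_isCtrlB {U V : Matrix (Fin 2 × Fin 2) (Fin 2 × Fin 2) ℂ}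
    (hUA : IsCtrlA U) (hVB : IsCtrlB V) : Swap 2 ≠ U * V := by
  intro hS
  obtain ⟨X, Y, hX, hY, hD⟩ := hUA
  obtain ⟨Z, W, hZ, hW, hE⟩ := hVB
  have hmid : (Y ⊗ₖ (1 : Matrix (Fin 2) (Fin 2) ℂ)) * (star Y ⊗ₖ star Z) *
      ((1 : Matrix (Fin 2) (Fin 2) ℂ) ⊗ₖ Z) = 1 := by
    rw [← Matrix.mul_kronecker_mul, ← Matrix.mul_kronecker_mul,
      Matrix.mem_unitaryGroup_iff.mp hY, one_mul, one_mul, Matrix.mem_unitaryGroup_iff'.mp hZ]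
    simp
  set D := (X ⊗ₖ (1 : Matrix (Fin 2) (Fin 2) ℂ)) * U * (Y ⊗ₖ (1 : Matrix (Fin 2) (Fin 2) ℂ))
    with hDdef
  set E := ((1 : Matrix (Fin 2) (Fin 2) ℂ) ⊗ₖ Z) * V * ((1 : Matrix (Fin 2) (Fin 2) ℂ) ⊗ₖ W)
    with hEdef
  have key : D * (star Y ⊗ₖ star Z) * E =
      (X ⊗ₖ (1 : Matrix (Fin 2) (Fin 2) ℂ)) * Swap 2 *
        ((1 : Matrix (Fin 2) (Fin 2) ℂ) ⊗ₖ W) := by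
    calc _ = (X ⊗ₖ (1 : Matrix (Fin 2) (Fin 2) ℂ)) * U *
          ((Y ⊗ₖ (1 : Matrix (Fin 2) (Fin 2) ℂ)) * (star Y ⊗ₖ star Z) *
          ((1 : Matrix (Fin 2) (Fin 2) ℂ) ⊗ₖ Z)) * V *
          ((1 : Matrix (Fin 2) (Fin 2) ℂ) ⊗ₖ W) := by
          simp only [hDdef, hEdef, mul_assoc]
      _ = _ := by rw [hmid, hS]; simp only [mul_assoc, one_mul]
  obtain ⟨i, l, hil⟩ := exists_apply_ne_zero_of_mem_unitaryGroup (mul_mem hX hW)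
  have hrank : ∀ k j, (∑ b, D (i, k) (i, b) * star Z b l) * (∑ c, star Y i c * E (c, l) (j, l)) =
      if k = j then (X * W) i l else 0 := by
    intro k j
    rw [← kronecker_one_mul_swap_mul_one_kronecker_apply, ← key, hE.apply_mul]
    simp only [hD.mul_apply, Matrix.kroneckerMap_apply, Fin.sum_univ_two]
    ring
  have h00 := hrank 0 0
  have h01 := hrank 0 1
  have h11 := hrank 1 1
  simp only [if_true, zero_ne_one, if_false] at h00 h01 h11
  rcases mul_eq_zero.mp h01 with h | h
  · rw [h, zero_mul] at h00
    exact hil h00.symm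
  · rw [h, mul_zero] at h11
    exact hil h11.symm

lemma kronecker_submatrix_swap {dA dB : ℕ} (X : Matrix (Fin dA) (Fin dA) ℂ)
    (Y : Matrix (Fin dB) (Fin dB) ℂ) :
    (X ⊗ₖ Y).submatrix (Equiv.prodComm _ _) (Equiv.prodComm _ _) = Y ⊗ₖ X := by
  ext ⟨_, _⟩ ⟨_, _⟩
  simp [mul_comm]

lemma IsCtrlA.submatrix_swap {dA dB : ℕ} {U : Matrix (Fin dA × Fin dB) (Fin dA × Fin dB) ℂ}
    (hU : IsCtrlA U) : IsCtrlB (U.submatrix (Equiv.prodComm _ _) (Equiv.prodComm _ _)) := by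
  obtain ⟨X, Y, hX, hY, h⟩ := hU
  refine ⟨X, Y, hX, hY, ?_⟩
  rw [← kronecker_submatrix_swap X, ← kronecker_submatrix_swap Y, Matrix.submatrix_mul_equiv,
    Matrix.submatrix_mul_equiv]
  exact fun p q hpq => h _ _ hpq

lemma IsCtrlB.submatrix_swap {dA dB : ℕ} {U : Matrix (Fin dA × Fin dB) (Fin dA × Fin dB) ℂ}
    (hU : IsCtrlB U) : IsCtrlA (U.submatrix (Equiv.prodComm _ _) (Equiv.prodComm _ _)) := by
  obtain ⟨X, Y, hX, hY, h⟩ := hU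
  refine ⟨X, Y, hX, hY, ?_⟩
  rw [← kronecker_submatrix_swap _ X, ← kronecker_submatrix_swap _ Y, Matrix.submatrix_mul_equiv,
    Matrix.submatrix_mul_equiv]
  exact fun p q hpq => h _ _ hpq

lemma submatrix_swap_mem_unitaryGroup {dA dB : ℕ}
    {U : Matrix (Fin dA × Fin dB) (Fin dA × Fin dB) ℂ}
    (hU : U ∈ Matrix.unitaryGroup (Fin dA × Fin dB) ℂ) :
    U.submatrix (Equiv.prodComm _ _) (Equiv.prodComm _ _) ∈
      Matrix.unitaryGroup (Fin dB × Fin dA) ℂ := by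
  rw [Matrix.mem_unitaryGroup_iff] at hU ⊢
  rw [Matrix.star_eq_conjTranspose, Matrix.conjTranspose_submatrix, Matrix.submatrix_mul_equiv,
    ← Matrix.star_eq_conjTranspose, hU, Matrix.submatrix_one_equiv]

lemma swap_submatrix_swap (d : ℕ) :
    (Swap d).submatrix (Equiv.prodComm _ _) (Equiv.prodComm _ _) = Swap d := by
  ext ⟨_, _⟩ ⟨_, _⟩
  simp [Swap, and_comm]

lemma swap_mem_unitaryGroup (d : ℕ) : Swap d ∈ Matrix.unitaryGroup (Fin d × Fin d) ℂ := by
  rw [Matrix.mem_unitaryGroup_iff]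
  ext ⟨a, b⟩ ⟨c, e⟩
  simp [Matrix.mul_apply, Fintype.sum_prod_type, Swap, Matrix.one_apply, ite_and,
    Matrix.star_apply, apply_ite, eq_comm]
  split_ifs <;> simp_all

/-- There is a two-qubit unitary that is not the product of two controlled unitaries. -/
theorem exists_not_two_ctrl :
    ∃ U : Matrix (Fin 2 × Fin 2) (Fin 2 × Fin 2) ℂ,
      U ∈ Matrix.unitaryGroup (Fin 2 × Fin 2) ℂ ∧
      ¬ ∃ U₁ U₂ : Matrix (Fin 2 × Fin 2) (Fin 2 × Fin 2) ℂ,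
        IsCtrlUnitary U₁ ∧ IsCtrlUnitary U₂ ∧ U = U₁ * U₂ := by
  refine ⟨Swap 2, swap_mem_unitaryGroup 2, ?_⟩
  rintro ⟨U, V, ⟨hU, hU'⟩, ⟨hV, hV'⟩, h⟩
  have h' : Swap 2 = U.submatrix (Equiv.prodComm _ _) (Equiv.prodComm _ _) *
      V.submatrix (Equiv.prodComm _ _) (Equiv.prodComm _ _) := by
    rw [Matrix.submatrix_mul_equiv, ← h, swap_submatrix_swap]
  rcases hU' with hUA | hUB <;> rcases hV' with hVA | hVB
  · exact swap_ne_mul_of_isCtrlA_of_isCtrlA hU hV hUA hVA h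
  · exact swap_ne_mul_of_isCtrlA_of_isCtrlB hUA hVB h
  · exact swap_ne_mul_of_isCtrlA_of_isCtrlB hUB.submatrix_swap hVA.submatrix_swap h'
  · exact swap_ne_mul_of_isCtrlA_of_isCtrlA (submatrix_swap_mem_unitaryGroup hU)
      (submatrix_swap_mem_unitaryGroup hV) hUB.submatrix_swap hVB.submatrix_swap h'
end

section
/- Let d_A = 2^k for some integer k ≥ 0 and let d_B ≥ 1. Then every unitary on the d_A × d_B system has a (2·d_A − 1)-sandwich form. -/
open Matrix Kronecker BigOperators

/-- `U` has an `m`-sandwich form: `U = U₁ U₂ ⋯ U_m` with each `Uᵢ` a unitary controlled in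
the computational basis, from the A side for odd `i` and from the B side for even `i`. -/
def HasSandwichForm {dA dB : ℕ} (m : ℕ)
    (U : Matrix (Fin dA × Fin dB) (Fin dA × Fin dB) ℂ) : Prop :=
  ∃ f : Fin m → Matrix (Fin dA × Fin dB) (Fin dA × Fin dB) ℂ,
    (∀ i, f i ∈ Matrix.unitaryGroup (Fin dA × Fin dB) ℂ) ∧
    (∀ i : Fin m, Odd ((i : ℕ) + 1) → CtrlAcb (f i)) ∧
    (∀ i : Fin m, Even ((i : ℕ) + 1) → CtrlBcb (f i)) ∧
    U = (List.ofFn f).prod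

section CosineSine

variable {n : Type*} [Fintype n] [DecidableEq n]

/-- A square matrix whose columns are pairwise orthogonal is a unitary times a diagonal matrix. -/
theorem exists_unitary_mul_diagonal_of_conjTranspose_mul_self_eq_diagonal
    {A : Matrix n n ℂ} {d : n → ℂ} (hA : Aᴴ * A = diagonal d) :
    ∃ V ∈ unitaryGroup n ℂ, ∃ e : n → ℂ, A = V * diagonal e := by
  let c : n → EuclideanSpace ℂ n := fun j => WithLp.toLp 2 (fun i => A i j)
  have hc : ∀ i j, inner ℂ (c i) (c j) = (diagonal d : Matrix n n ℂ) i j := fun i j => by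
    rw [← hA]
    simp [c, PiLp.inner_apply, mul_apply, conjTranspose_apply, mul_comm]
  let v : n → EuclideanSpace ℂ n := fun j => ((‖c j‖ : ℂ)⁻¹) • c j
  let s : Set n := {j | c j ≠ 0}
  have hv : Orthonormal ℂ (s.domRestrict v) := by
    constructor
    · rintro ⟨j, hj⟩
      have : ‖c j‖ ≠ 0 := norm_ne_zero_iff.mpr hj
      simp [Set.domRestrict_apply, v, norm_smul, this]
    · rintro ⟨i, hi⟩ ⟨j, hj⟩ hij
      have : i ≠ j := fun h => hij (Subtype.ext h)
      simp [Set.domRestrict_apply, v, inner_smul_left, inner_smul_right, hc, this]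
  obtain ⟨b, hb⟩ := hv.exists_orthonormalBasis_extension_of_card_eq (by simp)
  refine ⟨Matrix.of fun i j => b j i, ?_, fun j => (‖c j‖ : ℂ), ?_⟩
  · rw [mem_unitaryGroup_iff', star_eq_conjTranspose]
    ext i j
    have h := orthonormal_iff_ite.mp b.orthonormal i j
    simp only [PiLp.inner_apply, RCLike.inner_apply] at h
    simp only [mul_apply, conjTranspose_apply, of_apply, one_apply, ← h]
    exact Finset.sum_congr rfl fun x _ => mul_comm _ _
  · ext i j
    rw [mul_diagonal, of_apply]
    by_cases hj : c j = 0
    · have : A i j = 0 := congrArg (fun x : EuclideanSpace ℂ n => x i) hj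
      simp [hj, this]
    · rw [hb j hj]
      have : (‖c j‖ : ℂ) ≠ 0 := by simpa using hj
      simp only [v, PiLp.smul_apply, smul_eq_mul, c] at this ⊢
      field_simp

theorem fromBlocks_mem_unitaryGroup {V W : Matrix n n ℂ} (hV : V ∈ unitaryGroup n ℂ)
    (hW : W ∈ unitaryGroup n ℂ) : fromBlocks V 0 0 W ∈ unitaryGroup (n ⊕ n) ℂ := by
  rw [mem_unitaryGroup_iff, star_eq_conjTranspose] at *
  simp [fromBlocks_conjTranspose, fromBlocks_multiply, hV, hW]

/-- A weak form of the cosine-sine decomposition. -/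
theorem exists_cosine_sine_decomposition {U : Matrix (n ⊕ n) (n ⊕ n) ℂ}
    (hU : U ∈ unitaryGroup (n ⊕ n) ℂ) :
    ∃ V₁ ∈ unitaryGroup n ℂ, ∃ V₂ ∈ unitaryGroup n ℂ,
    ∃ W₁ ∈ unitaryGroup n ℂ, ∃ W₂ ∈ unitaryGroup n ℂ, ∃ a b c d : n → ℂ,
      fromBlocks (diagonal a) (diagonal b) (diagonal c) (diagonal d) ∈ unitaryGroup (n ⊕ n) ℂ ∧
      U = fromBlocks V₁ 0 0 V₂ *
        fromBlocks (diagonal a) (diagonal b) (diagonal c) (diagonal d) *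
        fromBlocks W₁ 0 0 W₂ := by
  obtain ⟨A, B, C, D, rfl⟩ : ∃ A B C D, U = fromBlocks A B C D :=
    ⟨_, _, _, _, (fromBlocks_toBlocks U).symm⟩
  have hAC : Aᴴ * A + Cᴴ * C = 1 := by
    have h := mem_unitaryGroup_iff'.mp hU
    rw [star_eq_conjTranspose, fromBlocks_conjTranspose, fromBlocks_multiply,
      ← fromBlocks_one, fromBlocks_inj] at h
    exact h.1
  obtain ⟨W, hW, x, hx⟩ : ∃ W ∈ unitaryGroup n ℂ, ∃ x : n → ℂ,
      Wᴴ * (Aᴴ * A) * W = diagonal x := by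
    have hH : (Aᴴ * A).IsHermitian := isHermitian_conjTranspose_mul_self A
    have h := hH.conjStarAlgAut_star_eigenvectorUnitary
    rw [Unitary.conjStarAlgAut_star_apply] at h
    exact ⟨hH.eigenvectorUnitary, hH.eigenvectorUnitary.2, _, h⟩
  have hW' : Wᴴ * W = 1 := mem_unitaryGroup_iff'.mp hW
  have hW'' : W * Wᴴ = 1 := mem_unitaryGroup_iff.mp hW
  have hA : (A * W)ᴴ * (A * W) = diagonal x := by
    rw [← hx, conjTranspose_mul]; simp only [Matrix.mul_assoc]
  have hC : (C * W)ᴴ * (C * W) = diagonal (fun i => 1 - x i) := by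
    have : Cᴴ * C = 1 - Aᴴ * A := eq_sub_of_add_eq' hAC
    rw [conjTranspose_mul, Matrix.mul_assoc, ← Matrix.mul_assoc Cᴴ, this, Matrix.sub_mul,
      Matrix.mul_sub, Matrix.one_mul, hW', ← Matrix.mul_assoc, hx, ← diagonal_one, diagonal_sub]
  obtain ⟨V₁, hV₁, a, ha⟩ :=
    exists_unitary_mul_diagonal_of_conjTranspose_mul_self_eq_diagonal hA
  obtain ⟨V₂, hV₂, c, hc⟩ :=
    exists_unitary_mul_diagonal_of_conjTranspose_mul_self_eq_diagonal hC
  have hV₁' : V₁ᴴ * V₁ = 1 := mem_unitaryGroup_iff'.mp hV₁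
  have hV₂' : V₂ᴴ * V₂ = 1 := mem_unitaryGroup_iff'.mp hV₂
  have hac : ∀ i, star (a i) * a i + star (c i) * c i = 1 := by
    have h₁ : diagonal (star a) * diagonal a = (diagonal x : Matrix n n ℂ) := by
      rw [← hA, ha, conjTranspose_mul, diagonal_conjTranspose, Matrix.mul_assoc,
        ← Matrix.mul_assoc V₁ᴴ, hV₁', Matrix.one_mul]
    have h₂ : diagonal (star c) * diagonal c = (diagonal (fun i => 1 - x i) : Matrix n n ℂ) := by
      rw [← hC, hc, conjTranspose_mul, diagonal_conjTranspose, Matrix.mul_assoc,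
        ← Matrix.mul_assoc V₂ᴴ, hV₂', Matrix.one_mul]
    rw [diagonal_mul_diagonal] at h₁ h₂
    intro i
    have e₁ := congrFun (diagonal_injective h₁) i
    have e₂ := congrFun (diagonal_injective h₂) i
    simp only [Pi.star_apply] at e₁ e₂
    rw [e₁, e₂]; ring
  set M : Matrix (n ⊕ n) (n ⊕ n) ℂ :=
    fromBlocks (diagonal a) (diagonal (-star c)) (diagonal c) (diagonal (star a)) with hMdef
  have hM : M ∈ unitaryGroup (n ⊕ n) ℂ := by
    rw [mem_unitaryGroup_iff', star_eq_conjTranspose, fromBlocks_conjTranspose,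
      fromBlocks_multiply, ← fromBlocks_one]
    simp only [diagonal_conjTranspose, diagonal_mul_diagonal, diagonal_add, ← diagonal_one,
      ← diagonal_zero]
    congr 2 <;> ext i <;> have := hac i <;> simp at this ⊢
    · exact this
    · ring
    · ring
    · linear_combination this
  set V := fromBlocks V₁ 0 0 V₂
  have hV : V ∈ unitaryGroup (n ⊕ n) ℂ := fromBlocks_mem_unitaryGroup hV₁ hV₂
  set R := star M * (star V * (fromBlocks A B C D * fromBlocks W 0 0 1)) with hR
  have hRmem : R ∈ unitaryGroup (n ⊕ n) ℂ :=
    mul_mem (Unitary.star_mem hM) (mul_mem (Unitary.star_mem hV)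
      (mul_mem hU (fromBlocks_mem_unitaryGroup hW (one_mem _))))
  have hMM' : M * star M = 1 := mem_unitaryGroup_iff.mp hM
  have hVV' : V * star V = 1 := mem_unitaryGroup_iff.mp hV
  obtain ⟨b, d, hbd⟩ : ∃ b d, R = fromBlocks 1 b 0 d := by
    have h₁ : diagonal (star a) * diagonal a + diagonal (star c) * diagonal c =
        (1 : Matrix n n ℂ) := by
      rw [diagonal_mul_diagonal, diagonal_mul_diagonal, diagonal_add, ← diagonal_one]
      exact congrArg diagonal (funext hac)
    have h₂ : diagonal (star (-star c)) * diagonal a + diagonal (star (star a)) * diagonal c =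
        (0 : Matrix n n ℂ) := by
      rw [diagonal_mul_diagonal, diagonal_mul_diagonal, diagonal_add, ← diagonal_zero]
      congr 1; ext i; simp; ring
    refine ⟨diagonal (star a) * (V₁ᴴ * B) + diagonal (star c) * (V₂ᴴ * D),
      diagonal (star (-star c)) * (V₁ᴴ * B) + diagonal (star (star a)) * (V₂ᴴ * D), ?_⟩
    rw [hR, hMdef, star_eq_conjTranspose, star_eq_conjTranspose, fromBlocks_multiply]
    simp only [Matrix.mul_zero, add_zero, Matrix.mul_one, zero_add]
    rw [ha, hc, fromBlocks_conjTranspose, fromBlocks_conjTranspose, fromBlocks_multiply,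
      fromBlocks_multiply]
    simp only [conjTranspose_zero, Matrix.zero_mul, add_zero, zero_add, ← Matrix.mul_assoc,
      hV₁', hV₂', Matrix.one_mul, diagonal_conjTranspose, h₁, h₂]
  have hRR := mem_unitaryGroup_iff'.mp hRmem
  rw [hbd, star_eq_conjTranspose, fromBlocks_conjTranspose, fromBlocks_multiply,
    ← fromBlocks_one, fromBlocks_inj] at hRR
  obtain ⟨-, hb, -, hd⟩ := hRR
  obtain rfl : b = 0 := by simpa using hb
  have hd : dᴴ * d = 1 := by simpa using hd
  refine ⟨V₁, hV₁, V₂, hV₂, Wᴴ, Unitary.star_mem hW, d, mem_unitaryGroup_iff'.mpr hd,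
    a, -star c, c, star a, hM, ?_⟩
  have hWd : fromBlocks Wᴴ 0 0 d = R * fromBlocks Wᴴ 0 0 1 := by
    simp [hbd, fromBlocks_multiply]
  have hWW : fromBlocks W 0 0 1 * fromBlocks Wᴴ 0 0 1 = (1 : Matrix (n ⊕ n) (n ⊕ n) ℂ) := by
    simp [fromBlocks_multiply, hW'']
  calc fromBlocks A B C D
      = V * (M * star M) * star V * fromBlocks A B C D *
          (fromBlocks W 0 0 1 * fromBlocks Wᴴ 0 0 1) := by simp [hMM', hVV', hWW]
    _ = V * M * fromBlocks Wᴴ 0 0 d := by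
      rw [hWd, hR]
      simp only [Matrix.mul_assoc]

end CosineSine

section BlockSum

variable {α β γ : Type}

/-- Splitting the first index of a product into two halves. -/
def splitFst (e : α ≃ γ ⊕ γ) : α × β ≃ (γ × β) ⊕ (γ × β) :=
  (e.prodCongr (Equiv.refl β)).trans (Equiv.sumProdDistrib γ γ β)

/-- The block sum of two matrices, with the first index reindexed along `e`. -/
def blockSum (e : α ≃ γ ⊕ γ) (V W : Matrix (γ × β) (γ × β) ℂ) : Matrix (α × β) (α × β) ℂ :=
  (fromBlocks V 0 0 W).submatrix (splitFst e) (splitFst e)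

theorem blockSum_mul [Fintype α] [Fintype β] [Fintype γ] (e : α ≃ γ ⊕ γ)
    (V W V' W' : Matrix (γ × β) (γ × β) ℂ) :
    blockSum e (V * V') (W * W') = blockSum e V W * blockSum e V' W' := by
  simp [blockSum, submatrix_mul_equiv, fromBlocks_multiply]

theorem blockSum_apply_eq_zero_of_fst_ne (e : α ≃ γ ⊕ γ) {V W : Matrix (γ × β) (γ × β) ℂ}
    (hV : ∀ p q : γ × β, p.1 ≠ q.1 → V p q = 0) (hW : ∀ p q : γ × β, p.1 ≠ q.1 → W p q = 0)
    (p q : α × β) (hpq : p.1 ≠ q.1) : blockSum e V W p q = 0 := by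
  obtain ⟨i, j⟩ := p
  obtain ⟨i', j'⟩ := q
  have h : e i ≠ e i' := e.injective.ne hpq
  rcases hi : e i with x | x <;> rcases hi' : e i' with y | y <;>
    simp [blockSum, splitFst, hi, hi'] at h ⊢
  · exact hV _ _ h
  · exact hW _ _ h

theorem fromBlocks_submatrix_apply_eq_zero_of_snd_ne (e : α ≃ γ ⊕ γ)
    {A B C D : Matrix (γ × β) (γ × β) ℂ}
    (hA : ∀ p q : γ × β, p.2 ≠ q.2 → A p q = 0) (hB : ∀ p q : γ × β, p.2 ≠ q.2 → B p q = 0)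
    (hC : ∀ p q : γ × β, p.2 ≠ q.2 → C p q = 0) (hD : ∀ p q : γ × β, p.2 ≠ q.2 → D p q = 0)
    (p q : α × β) (hpq : p.2 ≠ q.2) :
    (fromBlocks A B C D).submatrix (splitFst e) (splitFst e) p q = 0 := by
  obtain ⟨i, j⟩ := p
  obtain ⟨i', j'⟩ := q
  rcases hi : e i with x | x <;> rcases hi' : e i' with y | y <;>
    simp [splitFst, hi, hi']
  · exact hA _ _ hpq
  · exact hB _ _ hpq
  · exact hC _ _ hpq
  · exact hD _ _ hpq

end BlockSum

section Sandwich

variable {α β γ : Type} [Fintype α] [DecidableEq α] [Fintype β] [DecidableEq β]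
  [Fintype γ] [DecidableEq γ]

/-- `IsSandwich n U` says that `U` is a product of `2 * n + 1` unitaries that are alternately block
diagonal with respect to the first and to the second index, starting with the first. -/
def IsSandwich : ℕ → Matrix (α × β) (α × β) ℂ → Prop
  | 0, U => U ∈ unitaryGroup (α × β) ℂ ∧ ∀ p q : α × β, p.1 ≠ q.1 → U p q = 0
  | n + 1, U => ∃ P ∈ unitaryGroup (α × β) ℂ, ∃ Q ∈ unitaryGroup (α × β) ℂ,
      ∃ R : Matrix (α × β) (α × β) ℂ, (∀ p q : α × β, p.1 ≠ q.1 → P p q = 0) ∧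
      (∀ p q : α × β, p.2 ≠ q.2 → Q p q = 0) ∧ IsSandwich n R ∧ U = P * (Q * R)

theorem IsSandwich.mul {m n : ℕ} {U Q V : Matrix (α × β) (α × β) ℂ} (hU : IsSandwich m U)
    (hQ : Q ∈ unitaryGroup (α × β) ℂ) (hQ' : ∀ p q : α × β, p.2 ≠ q.2 → Q p q = 0)
    (hV : IsSandwich n V) : IsSandwich (m + n + 1) (U * Q * V) := by
  induction m generalizing U with
  | zero =>
    rw [zero_add]
    exact ⟨U, hU.1, Q, hQ, V, hU.2, hQ', hV, Matrix.mul_assoc _ _ _⟩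
  | succ m ih =>
    obtain ⟨P, hP, S, hS, R, hP', hS', hR, rfl⟩ := hU
    rw [add_right_comm m 1 n]
    exact ⟨P, hP, S, hS, R * Q * V, hP', hS', ih hR, by simp only [Matrix.mul_assoc]⟩

theorem submatrix_equiv_mem_unitaryGroup {ι κ : Type*} [Fintype ι] [DecidableEq ι] [Fintype κ]
    [DecidableEq κ] (e : ι ≃ κ) {U : Matrix κ κ ℂ} (hU : U ∈ unitaryGroup κ ℂ) :
    U.submatrix e e ∈ unitaryGroup ι ℂ := by
  rw [mem_unitaryGroup_iff, star_eq_conjTranspose] at *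
  rw [conjTranspose_submatrix, submatrix_mul_equiv, hU, submatrix_one_equiv]

theorem blockSum_mem_unitaryGroup (e : α ≃ γ ⊕ γ) {V W : Matrix (γ × β) (γ × β) ℂ}
    (hV : V ∈ unitaryGroup (γ × β) ℂ) (hW : W ∈ unitaryGroup (γ × β) ℂ) :
    blockSum e V W ∈ unitaryGroup (α × β) ℂ :=
  submatrix_equiv_mem_unitaryGroup _ (fromBlocks_mem_unitaryGroup hV hW)

theorem IsSandwich.blockSum (e : α ≃ γ ⊕ γ) {n : ℕ} {V W : Matrix (γ × β) (γ × β) ℂ}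
    (hV : IsSandwich n V) (hW : IsSandwich n W) : IsSandwich n (blockSum e V W) := by
  induction n generalizing V W with
  | zero =>
    exact ⟨blockSum_mem_unitaryGroup e hV.1 hW.1,
      blockSum_apply_eq_zero_of_fst_ne e hV.2 hW.2⟩
  | succ n ih =>
    obtain ⟨P, hP, Q, hQ, R, hP', hQ', hR, rfl⟩ := hV
    obtain ⟨S, hS, T, hT, X, hS', hT', hX, rfl⟩ := hW
    refine ⟨_, blockSum_mem_unitaryGroup e hP hS, _, blockSum_mem_unitaryGroup e hQ hT, _,
      blockSum_apply_eq_zero_of_fst_ne e hP' hS', ?_, ih hR hX, ?_⟩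
    · exact fromBlocks_submatrix_apply_eq_zero_of_snd_ne e hQ' (fun _ _ _ => rfl)
        (fun _ _ _ => rfl) hT'
    · rw [blockSum_mul, blockSum_mul]

/-- Every unitary whose first index ranges over `2 ^ k` values is a product of `2 * 2 ^ k - 1`
alternating block diagonal unitaries. -/
theorem isSandwich_two_pow_sub_one (k : ℕ) (e : α ≃ Fin (2 ^ k))
    {U : Matrix (α × β) (α × β) ℂ} (hU : U ∈ unitaryGroup (α × β) ℂ) :
    IsSandwich (2 ^ k - 1) U := by
  induction k generalizing α with
  | zero =>
    have : Subsingleton α := by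
      rw [pow_zero] at e
      exact e.subsingleton
    exact ⟨hU, fun p q h => absurd (Subsingleton.elim _ _) h⟩
  | succ k ih =>
    have e' : α ≃ Fin (2 ^ k) ⊕ Fin (2 ^ k) :=
      e.trans ((finCongr (by ring)).trans finSumFinEquiv.symm)
    obtain ⟨V₁, hV₁, V₂, hV₂, W₁, hW₁, W₂, hW₂, a, b, c, d, hM, h⟩ :=
      exists_cosine_sine_decomposition
        (submatrix_equiv_mem_unitaryGroup (splitFst (β := β) e').symm hU)
    have hUeq : U = blockSum e' V₁ V₂ *
        (fromBlocks (diagonal a) (diagonal b) (diagonal c) (diagonal d)).submatrix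
          (splitFst e') (splitFst e') * blockSum e' W₁ W₂ := by
      rw [_root_.blockSum, _root_.blockSum, submatrix_mul_equiv, submatrix_mul_equiv, ← h]
      simp
    have hdiag : ∀ (x : Fin (2 ^ k) × β → ℂ) (p q : Fin (2 ^ k) × β), p.2 ≠ q.2 →
        diagonal x p q = 0 := fun x p q hpq =>
      diagonal_apply_ne _ fun h => hpq (congrArg Prod.snd h)
    have hk : 2 ^ (k + 1) - 1 = 2 ^ k - 1 + (2 ^ k - 1) + 1 := by
      have := Nat.one_le_two_pow (n := k)
      rw [pow_succ]; omega
    rw [hk, hUeq]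
    exact ((ih (Equiv.refl _) hV₁).blockSum e' (ih (Equiv.refl _) hV₂)).mul
      (submatrix_equiv_mem_unitaryGroup _ hM)
      (fromBlocks_submatrix_apply_eq_zero_of_snd_ne e' (hdiag a) (hdiag b) (hdiag c) (hdiag d))
      ((ih (Equiv.refl _) hW₁).blockSum e' (ih (Equiv.refl _) hW₂))

end Sandwich

theorem IsSandwich.hasSandwichForm {dA dB n : ℕ}
    {U : Matrix (Fin dA × Fin dB) (Fin dA × Fin dB) ℂ} (hU : IsSandwich n U) :
    HasSandwichForm (2 * n + 1) U := by
  induction n generalizing U with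
  | zero =>
    refine ⟨fun _ => U, fun _ => hU.1, fun _ _ => hU.2, fun i hi => ?_, by simp⟩
    simp at hi
  | succ n ih =>
    obtain ⟨P, hP, Q, hQ, R, hP', hQ', hR, rfl⟩ := hU
    obtain ⟨f, hf, hfA, hfB, rfl⟩ := ih hR
    refine ⟨Fin.cons (n := 2 * n + 2) P (Fin.cons (n := 2 * n + 1) Q f), ?_, ?_, ?_, ?_⟩
    · exact Fin.cases hP (Fin.cases hQ hf)
    · refine Fin.cases (fun _ => hP') (Fin.cases (fun h => ?_) fun i h => hfA i ?_)
      · exact absurd (show Odd 2 from h) (by decide)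
      · simpa [parity_simps] using h
    · refine Fin.cases (fun h => ?_) (Fin.cases (fun _ => hQ') fun i h => hfB i ?_)
      · simp at h
      · simpa [parity_simps] using h
    · change _ = (List.ofFn (n := 2 * n + 1 + 1 + 1) _).prod
      rw [List.ofFn_cons, List.ofFn_cons, List.prod_cons, List.prod_cons]

/-- When `d_A = 2^k`, every unitary on the `d_A × d_B` system has a
`(2 d_A − 1)`-sandwich form. -/
theorem sandwich_form_pow_two (k dA dB : ℕ) (hdA : dA = 2 ^ k) (hdB : 1 ≤ dB)
    (U : Matrix (Fin dA × Fin dB) (Fin dA × Fin dB) ℂ)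
    (hU : U ∈ Matrix.unitaryGroup (Fin dA × Fin dB) ℂ) :
    HasSandwichForm (2 * dA - 1) U := by
  have h := (isSandwich_two_pow_sub_one k (finCongr hdA) hU).hasSandwichForm
  have hk : 2 * (2 ^ k - 1) + 1 = 2 * dA - 1 := by
    have := Nat.one_le_two_pow (n := k)
    omega
  rwa [hk] at h
end
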